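/- Let Λ be a finite dimensional algebra and M a generator-cogenerator. Then the dominant dimension of End_Λ(M) equals rd(M) + 2, where rd(M) is the maximal r > 0 (or ∞) with Ext^i_Λ(M,M) = 0 for all 1 ≤ i ≤ r. -/

import Mathlib

open CategoryTheory CategoryTheory.Limits Opposite

universe u

namespace Rigidity

variable (Λ : Type u) [Ring Λ]

/-- `X` belongs to `add M`: it is a direct summand of a finite direct sum of copies of `M`. -/
def InAdd (M X : ModuleCat.{u} Λ) : Prop :=
  ∃ (r : ℕ) (Y : ModuleCat.{u} Λ), Nonempty ((X ⊞ Y) ≅ ⨁ (fun _ : Fin r => M))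

/-- An indecomposable object. -/
def Indec (X : ModuleCat.{u} Λ) : Prop :=
  ¬ IsZero X ∧ ∀ A B : ModuleCat.{u} Λ, Nonempty (X ≅ A ⊞ B) → IsZero A ∨ IsZero B

/-- A generator-cogenerator: `add M` contains the regular module and all
finitely generated injective modules. -/
def IsGenCogen (M : ModuleCat.{u} Λ) : Prop :=
  InAdd Λ M (ModuleCat.of Λ Λ) ∧
  ∀ I : ModuleCat.{u} Λ, Module.Finite Λ I → Injective I → InAdd Λ M I

/-- `g : A ⟶ X` is a right minimal `add M`-approximation. -/
def IsRMApprox (M : ModuleCat.{u} Λ) {A X : ModuleCat.{u} Λ} (g : A ⟶ X) : Prop :=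
  InAdd Λ M A ∧
  (∀ T : ModuleCat.{u} Λ, InAdd Λ M T → ∀ f : T ⟶ X, ∃ h : T ⟶ A, h ≫ g = f) ∧
  (∀ h : A ⟶ A, h ≫ g = g → IsIso h)

/-- `IsMSyzygy M X r W` : `W` is an `r`-th `M`-syzygy `Ω_M^r(X)` of `X`. -/
inductive IsMSyzygy (M : ModuleCat.{u} Λ) : ModuleCat.{u} Λ → ℕ → ModuleCat.{u} Λ → Prop
  | zero (X : ModuleCat.{u} Λ) : IsMSyzygy M X 0 X
  | succ (X : ModuleCat.{u} Λ) (r : ℕ) (W A : ModuleCat.{u} Λ) (g : A ⟶ W)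
      (hW : IsMSyzygy M X r W) (hg : IsRMApprox Λ M g) :
      IsMSyzygy M X (r + 1) (kernel g)

/-- The `M`-dimension of `X` is at most `r`. -/
def MdimLE (M X : ModuleCat.{u} Λ) (r : ℕ) : Prop :=
  ∃ W : ModuleCat.{u} Λ, IsMSyzygy Λ M X r W ∧ InAdd Λ M W

/-- projective dimension at most `r`, via a length `r` projective resolution. -/
def ProjDimLE (A : Type u) [Ring A] (N : ModuleCat.{u} A) (r : ℕ) : Prop :=
  ∃ (P : ℕ → ModuleCat.{u} A) (d : ∀ i : ℕ, P (i + 1) ⟶ P i) (f : P 0 ⟶ N),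
    (∀ i, Projective (P i)) ∧ (∀ i, r < i → IsZero (P i)) ∧ Epi f ∧
    (∃ w : d 0 ≫ f = 0, (ShortComplex.mk (d 0) f w).Exact) ∧
    (∀ i, ∃ w : d (i + 1) ≫ d i = 0, (ShortComplex.mk (d (i + 1)) (d i) w).Exact)

/-- global dimension at most `r`. -/
def GldimLE (A : Type u) [Ring A] (r : ℕ) : Prop :=
  ∀ N : ModuleCat.{u} A, ProjDimLE A N r

/-- the global dimension, as an element of `ℕ∞`. -/
noncomputable def gldim (A : Type u) [Ring A] : ℕ∞ :=
  sInf {c : ℕ∞ | ∃ r : ℕ, c = (r : ℕ∞) ∧ GldimLE A r}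

/-- dominant dimension at least `r`: there is an exact sequence
`0 → A → I^0 → ⋯ → I^(r-1)` with all `I^i` projective-injective. -/
def DomdimGE (A : Type u) [Ring A] (r : ℕ) : Prop :=
  ∃ (I : ℕ → ModuleCat.{u} A) (f : ModuleCat.of A A ⟶ I 0) (g : ∀ i : ℕ, I i ⟶ I (i + 1)),
    Mono f ∧ (∀ i, i < r → Injective (I i) ∧ Projective (I i)) ∧
    (2 ≤ r → ∃ w : f ≫ g 0 = 0, (ShortComplex.mk f (g 0) w).Exact) ∧
    (∀ i, i + 3 ≤ r → ∃ w : g i ≫ g (i + 1) = 0, (ShortComplex.mk (g i) (g (i + 1)) w).Exact)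

/-- the dominant dimension, as an element of `ℕ∞`. -/
noncomputable def domdim (A : Type u) [Ring A] : ℕ∞ :=
  sSup {c : ℕ∞ | ∃ r : ℕ, c = (r : ℕ∞) ∧ DomdimGE A r}

/-- the rigidity degree of a module, as an element of `ℕ∞`. -/
noncomputable def rigDeg [HasExt.{u} (ModuleCat.{u} Λ)] (M : ModuleCat.{u} Λ) : ℕ∞ :=
  sSup {c : ℕ∞ | ∃ r : ℕ, c = (r : ℕ∞) ∧ 0 < r ∧
    ∀ i : ℕ, 1 ≤ i → i ≤ r → Subsingleton (Abelian.Ext M M i)}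

/-- the rigidity dimension. -/
noncomputable def rigdim : ℕ∞ :=
  sSup {c : ℕ∞ | ∃ M : ModuleCat.{u} Λ, Module.Finite Λ M ∧ IsGenCogen Λ M ∧
    (∃ r : ℕ, GldimLE (End (op M)) r) ∧ c = domdim (End (op M))}

/-- An Auslander-Reiten (almost split) sequence. -/
def IsARSeq {X Y Z : ModuleCat.{u} Λ} (f : X ⟶ Y) (g : Y ⟶ Z) : Prop :=
  Mono f ∧ Epi g ∧ (∃ w : f ≫ g = 0, (ShortComplex.mk f g w).Exact) ∧
  Indec Λ X ∧ Indec Λ Z ∧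
  (¬ ∃ s : Z ⟶ Y, s ≫ g = 𝟙 Z) ∧
  (∀ (W : ModuleCat.{u} Λ) (h : W ⟶ Z), (¬ ∃ s : Z ⟶ W, s ≫ h = 𝟙 Z) →
    ∃ h' : W ⟶ Y, h' ≫ g = h)

/-- `X` has composition length `t`. -/
def HasCompLength (X : ModuleCat.{u} Λ) (t : ℕ) : Prop :=
  (∃ c : Fin (t + 1) → Submodule Λ X, StrictMono c ∧ c 0 = ⊥ ∧ c (Fin.last t) = ⊤) ∧
  ∀ r : ℕ, (∃ c : Fin (r + 1) → Submodule Λ X, StrictMono c ∧ c 0 = ⊥ ∧ c (Fin.last r) = ⊤) →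
    r ≤ t

section General

open Abelian

universe v w'

variable {C : Type w'} [Category.{v} C] [Abelian C]

/-- The sequence `0 ⟶ X ⟶ I 0 ⟶ I 1 ⟶ ⋯ ⟶ I (r + 1)` is exact, except possibly at its last
term. -/
structure IsCoresolution (r : ℕ) (X : C) (I : ℕ → C) (f : X ⟶ I 0)
    (g : ∀ i : ℕ, I i ⟶ I (i + 1)) : Prop where
  mono : Mono f
  exact_zero : ∃ w : f ≫ g 0 = 0, (ShortComplex.mk f (g 0) w).Exact
  exact_succ : ∀ i, i < r → ∃ w : g i ≫ g (i + 1) = 0, (ShortComplex.mk (g i) (g (i + 1)) w).Exact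

/-- Morphisms from `M` lift along `g i` as soon as they are killed by `g (i + 1)`, for `i < r`. -/
def HomExact (r : ℕ) (M : C) {I : ℕ → C} (g : ∀ i : ℕ, I i ⟶ I (i + 1)) : Prop :=
  ∀ i, i < r → ∀ h : M ⟶ I (i + 1), h ≫ g (i + 1) = 0 → ∃ h' : M ⟶ I i, h' ≫ g i = h

variable [HasExt.{u} C]

lemma ext_succ_subsingleton_iff {S : ShortComplex C} (hS : S.ShortExact) [Injective S.X₂]
    (M : C) (n : ℕ) :
    Subsingleton (Ext.{u} M S.X₃ (n + 1)) ↔ Subsingleton (Ext.{u} M S.X₁ (n + 2)) := by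
  constructor
  · intro h
    refine subsingleton_of_forall_eq 0 fun x => ?_
    obtain ⟨y, rfl⟩ := Ext.covariant_sequence_exact₁ M hS x (Ext.eq_zero_of_injective _)
      (n₀ := n + 1) rfl
    rw [Subsingleton.elim y 0, Ext.zero_comp]
  · intro h
    refine subsingleton_of_forall_eq 0 fun x => ?_
    obtain ⟨y, rfl⟩ := Ext.covariant_sequence_exact₃ M hS x (n₁ := n + 2) rfl
      (Subsingleton.elim _ _)
    rw [Ext.eq_zero_of_injective y, Ext.zero_comp]

lemma ext_one_subsingleton_iff {S : ShortComplex C} (hS : S.ShortExact) [Injective S.X₂]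
    (M : C) :
    Subsingleton (Ext.{u} M S.X₁ 1) ↔ ∀ h : M ⟶ S.X₃, ∃ h' : M ⟶ S.X₂, h' ≫ S.g = h := by
  constructor
  · intro hsub h
    obtain ⟨y, hy⟩ := Ext.covariant_sequence_exact₃ M hS (Ext.mk₀ h) (n₁ := 1) rfl
      (Subsingleton.elim _ _)
    obtain ⟨h', rfl⟩ := (Ext.mk₀_bijective _ _).2 y
    exact ⟨h', (Ext.mk₀_bijective _ _).1 (by rw [← hy, Ext.mk₀_comp_mk₀])⟩
  · intro hlift
    refine subsingleton_of_forall_eq 0 fun x => ?_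
    obtain ⟨y, rfl⟩ := Ext.covariant_sequence_exact₁ M hS x (Ext.eq_zero_of_injective _)
      (n₀ := 0) rfl
    obtain ⟨h, rfl⟩ := (Ext.mk₀_bijective _ _).2 y
    obtain ⟨h', rfl⟩ := hlift h
    rw [← Ext.mk₀_comp_mk₀, Ext.comp_assoc_of_second_deg_zero, hS.comp_extClass, Ext.comp_zero]

/-- The positive `Ext` groups are computed by a truncated injective coresolution. -/
theorem IsCoresolution.ext_subsingleton_iff (M : C) {r : ℕ} {X : C} {I : ℕ → C} {f : X ⟶ I 0}
    {g : ∀ i : ℕ, I i ⟶ I (i + 1)} (hI : IsCoresolution r X I f g)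
    (hinj : ∀ i, i < r + 2 → Injective (I i)) :
    (∀ i, 1 ≤ i → i ≤ r → Subsingleton (Ext.{u} M X i)) ↔ HomExact r M g := by
  induction r generalizing X I with
  | zero =>
    exact ⟨fun _ i hi => absurd hi (by lia), fun _ i h1 h2 => absurd h2 (by lia)⟩
  | succ r ih =>
    obtain ⟨hmono, ⟨w₀, ex₀⟩, ex⟩ := hI
    obtain ⟨w₁, ex₁⟩ := ex 0 (by lia)
    have : Injective (I 0) := hinj 0 (by lia)
    let S : ShortComplex C := ShortComplex.mk f (cokernel.π f) (by simp)
    have hS : S.ShortExact :=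
      { exact := ShortComplex.exact_of_g_is_cokernel _ (cokernelIsCokernel f)
        mono_f := hmono
        epi_g := inferInstanceAs (Epi (cokernel.π f)) }
    have : Injective S.X₂ := this
    let f' : cokernel f ⟶ I 1 := cokernel.desc f (g 0) w₀
    have hf' : cokernel.π f ≫ f' = g 0 := cokernel.π_desc _ _ _
    have hmono' : Mono f' := (ShortComplex.exact_iff_mono_cokernel_desc _).1 ex₀
    have w₁' : f' ≫ g 1 = 0 := by
      rw [← cancel_epi (cokernel.π f), reassoc_of% hf', w₁, comp_zero]
    have ex₁' : (ShortComplex.mk f' (g 1) w₁').Exact :=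
      (ShortComplex.exact_iff_of_epi_of_isIso_of_mono
        (S₁ := ShortComplex.mk (g 0) (g 1) w₁) (S₂ := ShortComplex.mk f' (g 1) w₁')
        { τ₁ := cokernel.π f
          τ₂ := 𝟙 _
          τ₃ := 𝟙 _
          comm₁₂ := by simp [hf'] }).1 ex₁
    have hI' : IsCoresolution r (cokernel f) (fun i => I (i + 1)) f' (fun i => g (i + 1)) :=
      ⟨hmono', ⟨w₁', ex₁'⟩, fun i hi => ex (i + 1) (by lia)⟩
    have key := ih hI' (fun i hi => hinj (i + 1) (by lia))
    have hone := ext_one_subsingleton_iff hS M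
    have hsucc := ext_succ_subsingleton_iff hS M
    have hzero : (∀ h : M ⟶ cokernel f, ∃ h' : M ⟶ I 0, h' ≫ cokernel.π f = h) ↔
        ∀ h : M ⟶ I 1, h ≫ g 1 = 0 → ∃ h' : M ⟶ I 0, h' ≫ g 0 = h := by
      constructor
      · intro H h hh
        obtain ⟨h', hh'⟩ := H (ex₁'.lift h hh)
        exact ⟨h', by rw [← hf', reassoc_of% hh']; exact ex₁'.lift_f h hh⟩
      · intro H h
        obtain ⟨h', hh'⟩ := H (h ≫ f') (by simp [w₁'])
        exact ⟨h', by rw [← cancel_mono f', Category.assoc, hf', hh']⟩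
    constructor
    · intro H i hi
      rcases i with _ | i
      · exact hzero.1 (hone.1 (H 1 le_rfl (by lia)))
      · refine key.1 (fun j h1 h2 => ?_) i (by lia)
        obtain ⟨n, rfl⟩ := Nat.exists_eq_add_of_le' h1
        exact (hsucc n).2 (H _ (by lia) (by lia))
    · intro H i h1 h2
      obtain ⟨n, rfl⟩ := Nat.exists_eq_add_of_le' h1
      rcases n with _ | n
      · exact hone.2 (hzero.2 (H 0 (by lia)))
      · exact (hsucc n).1 (key.2 (fun i hi => H (i + 1) (by lia)) _ (by lia) (by lia))

end General

section Adjunction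

universe v w'

variable {C : Type w'} [Category.{v} C] {D : Type*} [Category* D]

lemma isIso_unit_of_injective {F : C ⥤ D} {T : D ⥤ C} (adj : T ⊣ F)
    [F.Full] [F.Faithful] (J : D) [Injective J] [Mono (adj.unit.app J)] :
    IsIso (adj.unit.app J) := by
  let _ : Reflective F := { L := T, adj := adj }
  have hm : Mono ((reflectorAdjunction F).unit.app J) := ‹Mono (adj.unit.app J)›
  have : IsSplitMono ((reflectorAdjunction F).unit.app J) :=
    ⟨⟨{ retraction := Injective.factorThru (𝟙 J) ((reflectorAdjunction F).unit.app J)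
        id := Injective.comp_factorThru _ _ }⟩⟩
  exact (mem_essImage_of_unit_isSplitMono (i := F)).unit_isIso

variable {A : Type u} [Ring A]

lemma mono_unit_of_projective {F : C ⥤ ModuleCat.{u} A} {T : ModuleCat.{u} A ⥤ C} (adj : T ⊣ F)
    [F.Full] [F.Faithful] {M : C} (e : F.obj M ≅ ModuleCat.of A A) (J : ModuleCat.{u} A)
    [Projective J] : Mono (adj.unit.app J) := by
  have hP : Module.Projective A J := (IsProjective.iff_projective J).2 inferInstance
  rw [ModuleCat.mono_iff_injective, injective_iff_map_eq_zero]
  intro x hx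
  obtain ⟨s, hs⟩ := hP
  have hs0 : s x = 0 := by
    ext j
    let φ : J ⟶ ModuleCat.of A A := ModuleCat.ofHom (Finsupp.lapply j ∘ₗ s)
    have hiso : IsIso (adj.unit.app (ModuleCat.of A A)) :=
      adj.isIso_unit_app_of_iso e.symm
    have hnat := adj.unit.naturality φ
    have := ConcreteCategory.congr_hom hnat x
    have h0 : adj.unit.app (ModuleCat.of A A) (φ x) = 0 := by
      have h1 : (φ ≫ adj.unit.app _) x = (adj.unit.app J ≫ F.map (T.map φ)) x := this
      rw [ModuleCat.comp_apply, ModuleCat.comp_apply] at h1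
      rw [h1, hx, map_zero]
    have hinj := (ModuleCat.mono_iff_injective (adj.unit.app (ModuleCat.of A A))).1
      (IsIso.mono_of_iso _)
    exact hinj (h0.trans (map_zero _).symm)
  rw [← hs x, hs0, map_zero]

lemma exact_of_forall_lift {X Y Z : ModuleCat.{u} A} (f : X ⟶ Y) (g : Y ⟶ Z) (w : f ≫ g = 0)
    (h : ∀ h : ModuleCat.of A A ⟶ Y, h ≫ g = 0 → ∃ h' : ModuleCat.of A A ⟶ X, h' ≫ f = h) :
    (ShortComplex.mk f g w).Exact := by
  rw [ShortComplex.moduleCat_exact_iff]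
  intro y hy
  obtain ⟨h', hh'⟩ := h (ModuleCat.ofHom (LinearMap.toSpanSingleton A Y y)) (by
    ext
    simpa using! hy)
  refine ⟨h' (1 : A), ?_⟩
  have := ConcreteCategory.congr_hom hh' (1 : A)
  simpa using! this

lemma exists_lift_of_exact {X Y Z : ModuleCat.{u} A} {f : X ⟶ Y} {g : Y ⟶ Z} {w : f ≫ g = 0}
    (ex : (ShortComplex.mk f g w).Exact) (h : ModuleCat.of A A ⟶ Y) (hh : h ≫ g = 0) :
    ∃ h' : ModuleCat.of A A ⟶ X, h' ≫ f = h := by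
  have hproj : Projective (ModuleCat.of A A) :=
    ModuleCat.projective_of_free (Module.Basis.singleton Unit A)
  exact ⟨ex.liftFromProjective h hh, ex.liftFromProjective_comp h hh⟩

variable [Abelian C]

/-- A fully faithful right adjoint with exact left adjoint transports a suitable coresolution of
the object representing the regular module to one of the regular module. -/
theorem domdimGE_of_isCoresolution {F : C ⥤ ModuleCat.{u} A} {T : ModuleCat.{u} A ⥤ C}
    (adj : T ⊣ F) [F.Full] [F.Faithful] [PreservesFiniteLimits T] {M : C}
    (e : F.obj M ≅ ModuleCat.of A A) {r : ℕ} {I : ℕ → C} {f : M ⟶ I 0}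
    {g : ∀ i : ℕ, I i ⟶ I (i + 1)} (hI : IsCoresolution r M I f g) (hex : HomExact r M g)
    (hinj : ∀ i, i < r + 2 → Injective (I i))
    (hproj : ∀ i, i < r + 2 → Projective (F.obj (I i))) :
    DomdimGE A (r + 2) := by
  have : PreservesLimitsOfSize.{0, 0} F := adj.rightAdjoint_preservesLimits
  obtain ⟨hmono, ⟨w₀, ex₀⟩, ex⟩ := hI
  refine ⟨fun i => F.obj (I i), e.inv ≫ F.map f, fun i => F.map (g i), inferInstance,
    fun i hi => ⟨adj.map_injective _ (hinj i hi), hproj i hi⟩, fun _ => ?_, fun i hi => ?_⟩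
  · have w : (e.inv ≫ F.map f) ≫ F.map (g 0) = 0 := by
      rw [Category.assoc, ← F.map_comp, w₀, F.map_zero, comp_zero]
    refine ⟨w, exact_of_forall_lift _ _ w fun h hh => ?_⟩
    obtain ⟨h₁, hh₁⟩ := F.map_surjective (e.hom ≫ h)
    have hz : h₁ ≫ g 0 = 0 := F.map_injective (by
      rw [F.map_comp, hh₁, Category.assoc, hh, comp_zero, F.map_zero])
    refine ⟨e.inv ≫ F.map (ex₀.lift h₁ hz) ≫ e.hom, ?_⟩
    have hl : ex₀.lift h₁ hz ≫ f = h₁ := ex₀.lift_f h₁ hz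
    simp only [Category.assoc, Iso.hom_inv_id_assoc]
    rw [← F.map_comp, hl, hh₁, Iso.inv_hom_id_assoc]
  · obtain ⟨w₁, ex₁⟩ := ex i (by lia)
    have w : F.map (g i) ≫ F.map (g (i + 1)) = 0 := by rw [← F.map_comp, w₁, F.map_zero]
    refine ⟨w, exact_of_forall_lift _ _ w fun h hh => ?_⟩
    obtain ⟨h₁, hh₁⟩ := F.map_surjective (e.hom ≫ h)
    have hz : h₁ ≫ g (i + 1) = 0 := F.map_injective (by
      rw [F.map_comp, hh₁, Category.assoc, hh, comp_zero, F.map_zero])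
    obtain ⟨h₂, hh₂⟩ := hex i (by lia) h₁ hz
    refine ⟨e.inv ≫ F.map h₂, ?_⟩
    rw [Category.assoc, ← F.map_comp, hh₂, hh₁, Iso.inv_hom_id_assoc]

/-- Conversely, the left adjoint turns projective-injective coresolutions of the regular module
into injective coresolutions which stay exact under `Hom(M, -)`. -/
theorem exists_isCoresolution_of_domdimGE {F : C ⥤ ModuleCat.{u} A} {T : ModuleCat.{u} A ⥤ C}
    (adj : T ⊣ F) [F.Full] [F.Faithful] [PreservesFiniteLimits T] {M : C}
    (e : F.obj M ≅ ModuleCat.of A A) {r : ℕ} (h : DomdimGE A (r + 2)) :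
    ∃ (I : ℕ → C) (f : M ⟶ I 0) (g : ∀ i : ℕ, I i ⟶ I (i + 1)),
      IsCoresolution r M I f g ∧ HomExact r M g ∧ ∀ i, i < r + 2 → Injective (I i) := by
  obtain ⟨J, f, g, hmono, hJ, ex₀, ex⟩ := h
  obtain ⟨w₀, ex₀⟩ := ex₀ (by lia)
  have : PreservesColimitsOfSize.{0, 0} T := adj.leftAdjoint_preservesColimits
  have hunit (i : ℕ) (hi : i < r + 2) : IsIso (adj.unit.app (J i)) := by
    obtain ⟨h₁, h₂⟩ := hJ i hi
    have := mono_unit_of_projective adj e (J i)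
    exact isIso_unit_of_injective adj (J i)
  have hinj (i : ℕ) (hi : i < r + 2) : Injective (T.obj (J i)) := by
    obtain ⟨h₁, h₂⟩ := hJ i hi
    have := hunit i hi
    exact adj.injective_of_map_injective _ (Injective.of_iso (asIso (adj.unit.app (J i))) h₁)
  let ε : M ≅ T.obj (ModuleCat.of A A) := (asIso (adj.counit.app M)).symm ≪≫ T.mapIso e
  refine ⟨fun i => T.obj (J i), ε.hom ≫ T.map f, fun i => T.map (g i), ⟨inferInstance, ?_, ?_⟩,
    ?_, hinj⟩
  · have w : (ε.hom ≫ T.map f) ≫ T.map (g 0) = 0 := by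
      rw [Category.assoc, ← T.map_comp, w₀, T.map_zero, comp_zero]
    refine ⟨w, ?_⟩
    refine (ShortComplex.exact_iff_of_iso (?_ : ShortComplex.mk _ _ w ≅
      (ShortComplex.mk f (g 0) w₀).map T)).2 (ex₀.map T)
    exact ShortComplex.isoMk ε (Iso.refl _) (Iso.refl _)
      (by exact (Category.comp_id _).symm)
      (by exact (Category.id_comp _).trans (Category.comp_id _).symm)
  · intro i hi
    obtain ⟨w₁, ex₁⟩ := ex i (by lia)
    exact ⟨by rw [← T.map_comp, w₁, T.map_zero], ex₁.map T⟩
  · intro i hi h hh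
    obtain ⟨w₁, ex₁⟩ := ex i (by lia)
    have := hunit (i + 1) (by lia)
    have := hunit (i + 2) (by lia)
    let φ : ModuleCat.of A A ⟶ J (i + 1) :=
      adj.homEquiv _ _ (ε.inv ≫ h) ≫ inv (adj.unit.app (J (i + 1)))
    have hφ : T.map φ = ε.inv ≫ h := by
      apply (adj.homEquiv _ _).injective
      rw [adj.homEquiv_unit (f := T.map φ)]
      refine (adj.unit_naturality φ).trans ?_
      simp [φ]
    have hm : Mono (adj.unit.app (J (i + 2))) := IsIso.mono_of_iso _
    have : PreservesLimitsOfSize.{0, 0} F := adj.rightAdjoint_preservesLimits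
    have hz : φ ≫ g (i + 1) = 0 := by
      rw [← cancel_mono (adj.unit.app (J (i + 2))), zero_comp]
      refine (adj.unit_naturality (φ ≫ g (i + 1))).symm.trans ?_
      have h0 : T.map (φ ≫ g (i + 1)) = 0 := by
        rw [T.map_comp, hφ, Category.assoc]
        exact (congrArg (ε.inv ≫ ·) hh).trans comp_zero
      rw [h0, F.map_zero, comp_zero]
    obtain ⟨ψ, hψ⟩ := exists_lift_of_exact ex₁ φ hz
    refine ⟨ε.hom ≫ T.map ψ, ?_⟩
    rw [Category.assoc, ← T.map_comp, hψ, hφ, Iso.hom_inv_id_assoc]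

end Adjunction

section FiniteInjective

variable {k : Type u} [Field k] {Λ : Type u} [Ring Λ] [Algebra k Λ] [FiniteDimensional k Λ]

lemma finite_restrictScalars (N : ModuleCat.{u} Λ) [Module.Finite Λ N] :
    Module.Finite k ((ModuleCat.restrictScalars (algebraMap k Λ)).obj N) := by
  let _ : Module k N := Module.compHom N (algebraMap k Λ)
  have : IsScalarTower k Λ N := .of_algebraMap_smul fun _ _ => rfl
  exact Module.Finite.trans (R := k) Λ N

lemma finite_coextendScalars (V : ModuleCat.{u} k) [Module.Finite k V] :
    Module.Finite Λ ((ModuleCat.coextendScalars (algebraMap k Λ)).obj V) := by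
  let X := (ModuleCat.coextendScalars (algebraMap k Λ)).obj V
  let _ : Module k X := Module.compHom X (algebraMap k Λ)
  have : IsScalarTower k Λ X := .of_algebraMap_smul fun _ _ => rfl
  have hmul (g : X) (c : k) (s : Λ) : g (algebraMap k Λ c * s) = c • g s :=
    (ModuleCat.CoextendScalars.equiv _ V g).map_smul c s
  let φ : X →ₗ[k] (Λ →ₗ[k] V) :=
    { toFun := fun g =>
        { toFun := fun s => g s
          map_add' := fun s t => (ModuleCat.CoextendScalars.equiv _ V g).map_add s t
          map_smul' := fun c s => by
            rw [Algebra.smul_def, hmul, RingHom.id_apply] }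
      map_add' := fun _ _ => rfl
      map_smul' := fun c g => LinearMap.ext fun s => by
        change (algebraMap k Λ c • g) s = c • g s
        rw [ModuleCat.CoextendScalars.smul_apply, ← hmul, Algebra.commutes] }
  have hφ : Function.Injective φ := fun g g' h =>
    ModuleCat.CoextendScalars.ext (LinearMap.ext fun s => LinearMap.congr_fun h s)
  have : Module.Finite k X := Module.Finite.of_injective φ hφ
  exact Module.Finite.of_restrictScalars_finite k Λ X

lemma injective_of_field {K : Type u} [Field K] (V : ModuleCat.{u} K) : Injective V :=
  (Module.injective_iff_injective_object K V).1 (Module.injective_of_isSemisimpleRing K V)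

/-- Finitely generated modules over a finite dimensional algebra embed into finitely generated
injective modules. -/
lemma exists_finite_injective_mono (k : Type u) [Field k] {Λ : Type u} [Ring Λ] [Algebra k Λ]
    [FiniteDimensional k Λ] (N : ModuleCat.{u} Λ) [Module.Finite Λ N] :
    ∃ (E : ModuleCat.{u} Λ) (j : N ⟶ E), Module.Finite Λ E ∧ Injective E ∧ Mono j := by
  let adj := ModuleCat.restrictCoextendScalarsAdj.{u, u, u} (algebraMap k Λ)
  have := finite_restrictScalars (k := k) N
  have hV := finite_coextendScalars (Λ := Λ) ((ModuleCat.restrictScalars (algebraMap k Λ)).obj N)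
  exact ⟨_, adj.unit.app N, hV, adj.map_injective _ (injective_of_field _), inferInstance⟩

/-- A coresolution by finitely generated injective modules. -/
lemma exists_finite_injective_coresolution (k : Type u) [Field k] {Λ : Type u} [Ring Λ]
    [Algebra k Λ] [FiniteDimensional k Λ] (N : ModuleCat.{u} Λ) [Module.Finite Λ N] (r : ℕ) :
    ∃ (I : ℕ → ModuleCat.{u} Λ) (f : N ⟶ I 0) (g : ∀ i : ℕ, I i ⟶ I (i + 1)),
      IsCoresolution r N I f g ∧ ∀ i, Module.Finite Λ (I i) ∧ Injective (I i) := by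
  choose E j hE using fun N : {N : ModuleCat.{u} Λ // Module.Finite Λ N} =>
    have := N.2
    exists_finite_injective_mono k N.1
  let K : ℕ → {N : ModuleCat.{u} Λ // Module.Finite Λ N} := fun n =>
    Nat.rec ⟨N, inferInstance⟩ (fun _ L => ⟨cokernel (j L), by
      have := (hE L).1
      exact Module.Finite.of_surjective (cokernel.π (j L)).hom
        ((ModuleCat.epi_iff_surjective _).1 inferInstance)⟩) n
  have hm (i : ℕ) : Mono (j (K i)) := (hE (K i)).2.2
  let π (i : ℕ) : E (K i) ⟶ (K (i + 1)).1 := cokernel.π (j (K i))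
  have hπ (i : ℕ) : Epi (π i) := inferInstanceAs (Epi (cokernel.π (j (K i))))
  have wπ (i : ℕ) : j (K i) ≫ π i = 0 := cokernel.condition (j (K i))
  have exπ (i : ℕ) : (ShortComplex.mk (j (K i)) (π i) (wπ i)).Exact :=
    ShortComplex.exact_of_g_is_cokernel _ (cokernelIsCokernel (j (K i)))
  have w (i : ℕ) : j (K i) ≫ π i ≫ j (K (i + 1)) = 0 := by
    rw [← Category.assoc, wπ, zero_comp]
  have ex (i : ℕ) : (ShortComplex.mk (j (K i)) (π i ≫ j (K (i + 1))) (w i)).Exact :=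
    let φ : ShortComplex.mk (j (K i)) (π i) (wπ i) ⟶
        ShortComplex.mk (j (K i)) (π i ≫ j (K (i + 1))) (w i) :=
      { τ₁ := 𝟙 _
        τ₂ := 𝟙 _
        τ₃ := j (K (i + 1)) }
    have : IsIso φ.τ₁ := inferInstanceAs (IsIso (𝟙 _))
    have : IsIso φ.τ₂ := inferInstanceAs (IsIso (𝟙 _))
    have : Mono φ.τ₃ := hm (i + 1)
    (ShortComplex.exact_iff_of_epi_of_isIso_of_mono φ).1 (exπ i)
  refine ⟨fun i => E (K i), j (K 0), fun i => π i ≫ j (K (i + 1)), ⟨hm 0, ⟨w 0, ex 0⟩,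
    fun i _ => ?_⟩, fun i => ⟨(hE (K i)).1, (hE (K i)).2.1⟩⟩
  have w' : (π i ≫ j (K (i + 1))) ≫ π (i + 1) ≫ j (K (i + 2)) = 0 :=
    (Category.assoc _ _ _).trans ((congrArg (π i ≫ ·) (w (i + 1))).trans comp_zero)
  exact ⟨w', (ShortComplex.exact_iff_of_epi_of_isIso_of_mono
        (S₁ := ShortComplex.mk (π i ≫ j (K (i + 1))) _ w')
        (S₂ := ShortComplex.mk (j (K (i + 1))) (π (i + 1) ≫ j (K (i + 2))) (w (i + 1)))
        { τ₁ := π i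
          τ₂ := 𝟙 _
          τ₃ := 𝟙 _ }).2 (ex (i + 1))⟩

end FiniteInjective

section GeneratorCogenerator

variable {Λ : Type u} [Ring Λ]

lemma InAdd.exists_retract {M X : ModuleCat.{u} Λ} (h : InAdd Λ M X) :
    ∃ r : ℕ, Nonempty (Retract X (⨁ (fun _ : Fin r => M))) := by
  obtain ⟨r, Y, ⟨e⟩⟩ := h
  exact ⟨r, ⟨{ i := biprod.inl ≫ e.hom, r := e.inv ≫ biprod.fst }⟩⟩

lemma isSeparator_of_inAdd {M : ModuleCat.{u} Λ} (h : InAdd Λ M (ModuleCat.of Λ Λ)) :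
    IsSeparator M := by
  obtain ⟨r, ⟨ρ⟩⟩ := h.exists_retract
  refine (Preadditive.isSeparator_iff M).2 fun X Y f hf => ?_
  ext x
  let p : ModuleCat.of Λ Λ ⟶ X := ModuleCat.ofHom (LinearMap.toSpanSingleton Λ X x)
  have hp : (ρ.r ≫ p) ≫ f = 0 := biproduct.hom_ext' _ _ fun i => by
    rw [← Category.assoc, hf, comp_zero]
  have hpf : p ≫ f = 0 := by
    rw [← Category.id_comp (p ≫ f), ← ρ.retract, Category.assoc, ← Category.assoc ρ.r, hp,
      comp_zero]
  have := ConcreteCategory.congr_hom hpf (1 : Λ)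
  simpa [p] using! this

lemma projective_biproduct {A : Type u} [Ring A] {r : ℕ} (P : Fin r → ModuleCat.{u} A)
    (h : ∀ i, Projective (P i)) : Projective (⨁ P) where
  factors f p _ := ⟨biproduct.desc fun i => Projective.factorThru (biproduct.ι P i ≫ f) p,
    biproduct.hom_ext' _ _ fun i => by simp⟩

lemma projective_of_inAdd {A : Type u} [Ring A] (F : ModuleCat.{u} Λ ⥤ ModuleCat.{u} A)
    [PreservesFiniteLimits F] {M X : ModuleCat.{u} Λ} (e : F.obj M ≅ ModuleCat.of A A)
    (h : InAdd Λ M X) : Projective (F.obj X) := by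
  have hA : Projective (ModuleCat.of A A) :=
    ModuleCat.projective_of_free (Module.Basis.singleton Unit A)
  have hM : Projective (F.obj M) := Projective.of_iso e.symm hA
  obtain ⟨r, ⟨ρ⟩⟩ := h.exists_retract
  have : PreservesFiniteBiproducts F := by
    have := preservesBinaryBiproducts_of_preservesBinaryProducts F
    have := Functor.additive_of_preservesBinaryBiproducts F
    infer_instance
  have : Projective (F.obj (⨁ (fun _ : Fin r => M))) :=
    Projective.of_iso (F.mapBiproduct _).symm (projective_biproduct _ fun _ => hM)
  exact (ρ.map F).projective

/-- The endomorphism ring of `op M` is the opposite of the endomorphism ring of `M`. -/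
def endOpEquiv {C : Type*} [Category* C] [Preadditive C] (M : C) :
    End (op M) ≃+* (End M)ᵐᵒᵖ where
  toFun f := MulOpposite.op (Quiver.Hom.unop f)
  invFun f := Quiver.Hom.op (MulOpposite.unop f)
  left_inv _ := rfl
  right_inv _ := rfl
  map_mul' _ _ := rfl
  map_add' _ _ := rfl

/-- The data needed to compare `Λ`-modules with modules over the endomorphism ring of a generator
`M`: a fully faithful functor with exact left adjoint, sending `M` to the regular module. -/
lemma exists_adjunction_of_isSeparator {M : ModuleCat.{u} Λ} (hM : IsSeparator M) :
    ∃ (F : ModuleCat.{u} Λ ⥤ ModuleCat.{u} (End (op M)))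
      (T : ModuleCat.{u} (End (op M)) ⥤ ModuleCat.{u} Λ) (_ : T ⊣ F),
      F.Full ∧ F.Faithful ∧ PreservesFiniteLimits T ∧
        Nonempty (F.obj M ≅ ModuleCat.of (End (op M)) (End (op M))) := by
  let E := ModuleCat.restrictScalarsEquivalenceOfRingEquiv.{u} (endOpEquiv M)
  have := IsGrothendieckAbelian.GabrielPopescu.full M hM
  have := (isSeparator_iff_faithful_preadditiveCoyonedaObj M).1 hM
  have := IsGrothendieckAbelian.GabrielPopescu.preservesFiniteLimits M hM
  exact ⟨preadditiveCoyonedaObj M ⋙ E.functor, E.inverse ⋙ IsGrothendieckAbelian.tensorObj M,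
    E.symm.toAdjunction.comp
      (IsGrothendieckAbelian.tensorObjPreadditiveCoyonedaObjAdjunction M),
    inferInstance, inferInstance, comp_preservesFiniteLimits _ _,
    ⟨E.functor.mapIso (Preadditive.homSelfLinearEquivEndMulOpposite M).toModuleIso ≪≫
      ModuleCat.restrictScalarsIsoOfEquiv (endOpEquiv M)⟩⟩

theorem domdimGE_iff (k : Type u) [Field k] {Λ : Type u} [Ring Λ] [Algebra k Λ]
    [FiniteDimensional k Λ] [HasExt.{u} (ModuleCat.{u} Λ)] {M : ModuleCat.{u} Λ}
    (hfin : Module.Finite Λ M) (hM : IsGenCogen Λ M) (r : ℕ) :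
    DomdimGE (End (op M)) (r + 2) ↔
      ∀ i : ℕ, 1 ≤ i → i ≤ r → Subsingleton (Abelian.Ext.{u} M M i) := by
  obtain ⟨F, T, adj, _, _, _, ⟨e⟩⟩ :=
    exists_adjunction_of_isSeparator (isSeparator_of_inAdd hM.1)
  constructor
  · intro h
    obtain ⟨I, f, g, hI, hex, hinj⟩ := exists_isCoresolution_of_domdimGE adj e h
    exact (hI.ext_subsingleton_iff M hinj).2 hex
  · intro h
    obtain ⟨I, f, g, hI, hinj⟩ := exists_finite_injective_coresolution k M r
    have : PreservesLimitsOfSize.{0, 0} F := adj.rightAdjoint_preservesLimits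
    exact domdimGE_of_isCoresolution adj e hI
      ((hI.ext_subsingleton_iff M fun i _ => (hinj i).2).1 h) (fun i _ => (hinj i).2)
      fun i _ => projective_of_inAdd F e (hM.2 _ (hinj i).1 (hinj i).2)

end GeneratorCogenerator

/-- Müller's theorem: for a generator-cogenerator `M` over a finite
dimensional algebra `Λ`, `domdim End_Λ(M) = rd(M) + 2`. -/
theorem statement12 (k : Type u) [Field k] (Λ : Type u) [Ring Λ] [Algebra k Λ]
    [FiniteDimensional k Λ]
    [HasExt.{u} (ModuleCat.{u} Λ)]
    (M : ModuleCat.{u} Λ) (hMfin : Module.Finite Λ M) (hgc : IsGenCogen Λ M) :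
    domdim (End (op M)) = rigDeg Λ M + 2 := by
  have key := domdimGE_iff k hMfin hgc
  apply le_antisymm
  · refine sSup_le ?_
    rintro _ ⟨r, rfl, hr⟩
    rcases le_or_gt r 2 with h | h
    · exact le_add_left (by exact_mod_cast h)
    · obtain ⟨s, rfl⟩ := Nat.exists_eq_add_of_le' h.le
      push_cast
      gcongr
      exact le_sSup ⟨s, rfl, by lia, (key s).1 hr⟩
  · rcases Set.eq_empty_or_nonempty {c : ℕ∞ | ∃ r : ℕ, c = (r : ℕ∞) ∧ 0 < r ∧
      ∀ i : ℕ, 1 ≤ i → i ≤ r → Subsingleton (Abelian.Ext M M i)} with h | h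
    · rw [rigDeg, h, sSup_empty, bot_eq_zero, zero_add]
      exact le_sSup ⟨2, rfl, (key 0).2 fun i h1 h2 => absurd h2 (by lia)⟩
    · rw [rigDeg, ENat.sSup_add h]
      refine iSup₂_le ?_
      rintro _ ⟨r, rfl, _, hr⟩
      exact le_sSup ⟨r + 2, by push_cast; rfl, (key r).2 hr⟩

end Rigidity
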